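/- arXiv:1908.03915 — 3 statements merged into one kernel-verified Lean document; each statement's English description precedes it below -/
import Mathlib

section
/- Radial-to-general reduction lemma: Let N ≥ 2, 1 < q < ∞, R > 0, and let f be a nonnegative radial measurable function on B_R ⊂ ℝ^N. Suppose there exists C > 0 such that for every radial u ∈ C_c^1(B_R) one has C ∫_{B_R} |u(x)|^q f(x) dx ≤ ∫_{B_R} |∇u(x)|^q dx. Then for every (not necessarily radial) w ∈ C_c^1(B_R) one has C ∫_{B_R} |w(x)|^q f(x) dx ≤ ∫_{B_R} |∇w(x) · (x/|x|)|^q dx. -/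
open MeasureTheory Metric Set Filter

noncomputable section

namespace HS

abbrev Euc (N : ℕ) := EuclideanSpace ℝ (Fin N)

/-- smooth compactly supported test functions in the ball `B_R`. -/
def IsTest (N : ℕ) (R : ℝ) (u : Euc N → ℝ) : Prop :=
  ContDiff ℝ (⊤ : ℕ∞) u ∧ HasCompactSupport u ∧ tsupport u ⊆ ball (0 : Euc N) R

/-- a function is radial if it only depends on the norm. -/
def IsRadial {N : ℕ} (u : Euc N → ℝ) : Prop :=
  ∀ x y : Euc N, ‖x‖ = ‖y‖ → u x = u y

/-- the critical Hardy–Sobolev exponent `p*(s) = p(N-s)/(N-p)`. -/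
def pstar (N : ℕ) (p s : ℝ) : ℝ := p * ((N : ℝ) - s) / ((N : ℝ) - p)

/-- the exponent `β(s) = ((N-1)p - (p-1)s)/(N-p)`. -/
def beta (N : ℕ) (p s : ℝ) : ℝ := (((N : ℝ) - 1) * p - (p - 1) * s) / ((N : ℝ) - p)

/-- the potential `V_a(x) = |x|^{-s} (1 - a (|x|/R)^{(N-p)/(p-1)})^{-β(s)}`. -/
def Va (N : ℕ) (p s R a : ℝ) (x : Euc N) : ℝ :=
  ‖x‖ ^ (-s) * (1 - a * (‖x‖ / R) ^ (((N : ℝ) - p) / (p - 1))) ^ (-(beta N p s))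

/-- the gradient energy `∫_{B_R} |∇u|^p`. -/
def gradEn (N : ℕ) (p R : ℝ) (u : Euc N → ℝ) : ℝ :=
  ∫ x in ball (0 : Euc N) R, ‖fderiv ℝ u x‖ ^ p

/-- the denominator `(∫_{B_R} |u|^{p*(s)} V_a)^{p/p*(s)}`. -/
def denomV (N : ℕ) (p s R a : ℝ) (u : Euc N → ℝ) : ℝ :=
  (∫ x in ball (0 : Euc N) R, |u x| ^ pstar N p s * Va N p s R a x) ^ (p / pstar N p s)

/-- the Rayleigh-type quotient for the improved Hardy–Sobolev inequality. -/
def quotV (N : ℕ) (p s R a : ℝ) (u : Euc N → ℝ) : ℝ :=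
  gradEn N p R u / denomV N p s R a u

/-- `I_a` : the infimum of the quotient over nonzero functions of `W_0^{1,p}(B_R)`
(equivalently, by density, over nonzero test functions). -/
def Ia (N : ℕ) (p s R a : ℝ) : ℝ :=
  sInf (quotV N p s R a '' {u | IsTest N R u ∧ u ≠ 0})

/-- `I_{a,rad}` : the infimum of the quotient over nonzero radial functions. -/
def IaRad (N : ℕ) (p s R a : ℝ) : ℝ :=
  sInf (quotV N p s R a '' {u | IsTest N R u ∧ IsRadial u ∧ u ≠ 0})

/-- the best constant `C_{N,p,s}` in the classical Hardy–Sobolev inequality on `ℝ^N`. -/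
def HSC (N : ℕ) (p s : ℝ) : ℝ :=
  sInf ((fun u : Euc N → ℝ =>
      (∫ x : Euc N, ‖fderiv ℝ u x‖ ^ p) /
        (∫ x : Euc N, |u x| ^ pstar N p s * ‖x‖ ^ (-s)) ^ (p / pstar N p s)) ''
    {u : Euc N → ℝ | ContDiff ℝ (⊤ : ℕ∞) u ∧ HasCompactSupport u ∧ u ≠ 0})

/-- `u ∈ W_0^{1,p}(B_R)` with weak gradient `g` : `u` is a limit, in the `W^{1,p}` sense,
of test functions supported in `B_R`. -/
def MemW (N : ℕ) (p R : ℝ) (u : Euc N → ℝ) (g : Euc N → Euc N) : Prop :=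
  ∃ f : ℕ → Euc N → ℝ,
    (∀ n, IsTest N R (f n)) ∧
    Tendsto (fun n => ∫ x in ball (0 : Euc N) R, ‖gradient (f n) x - g x‖ ^ p)
      atTop (nhds (0 : ℝ)) ∧
    Tendsto (fun n => ∫ x in ball (0 : Euc N) R, |f n x - u x| ^ p) atTop (nhds (0 : ℝ))

/-- the quotient for a Sobolev function `u` with weak gradient `g`. -/
def quotW (N : ℕ) (p s R a : ℝ) (u : Euc N → ℝ) (g : Euc N → Euc N) : ℝ :=
  (∫ x in ball (0 : Euc N) R, ‖g x‖ ^ p) / denomV N p s R a u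

/-- a Sobolev function is nonzero if it is not a.e. zero on the ball. -/
def Nonzero (N : ℕ) (R : ℝ) (u : Euc N → ℝ) : Prop :=
  ¬ (u =ᵐ[volume.restrict (ball (0 : Euc N) R)] (fun _ => (0 : ℝ)))

/-- `I_a` is attained by some nonzero function of `W_0^{1,p}(B_R)`. -/
def Attained (N : ℕ) (p s R a : ℝ) : Prop :=
  ∃ u g, MemW N p R u g ∧ Nonzero N R u ∧ quotW N p s R a u g = Ia N p s R a

end HS

namespace HS

section RadialComposition

variable {E : Type*} [NormedAddCommGroup E] [InnerProductSpace ℝ E]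

theorem hasFDerivAt_comp_norm {ψ : ℝ → ℝ} (hψ : Differentiable ℝ ψ) (h0 : deriv ψ 0 = 0) (x : E) :
    HasFDerivAt (fun y : E => ψ ‖y‖) (deriv ψ ‖x‖ • fderiv ℝ (fun y : E => ‖y‖) x) x := by
  by_cases hx : x = 0
  · subst hx
    have h := (hψ 0).hasDerivAt
    rw [h0, hasDerivAt_iff_isLittleO] at h
    have hn : Tendsto (fun y : E => ‖y‖) (nhds 0) (nhds 0) := tendsto_norm_zero
    have h2 := h.comp_tendsto hn
    rw [norm_zero, h0, zero_smul, hasFDerivAt_iff_isLittleO]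
    refine (Asymptotics.isLittleO_norm_right (g' := fun y : E => y - 0)).1 ?_
    simpa [Function.comp_def] using h2
  · exact (hψ ‖x‖).hasDerivAt.comp_hasFDerivAt x
      ((contDiffAt_norm (n := 1) ℝ hx).differentiableAt one_ne_zero).hasFDerivAt

theorem norm_fderiv_norm_le (x : E) : ‖fderiv ℝ (fun y : E => ‖y‖) x‖ ≤ 1 := by
  simpa using norm_fderiv_le_of_lipschitz ℝ (lipschitzWith_one_norm (E := E)) (x₀ := x)

theorem norm_fderiv_comp_norm_le {ψ : ℝ → ℝ} (hψ : Differentiable ℝ ψ) (h0 : deriv ψ 0 = 0)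
    (x : E) : ‖fderiv ℝ (fun y : E => ψ ‖y‖) x‖ ≤ |deriv ψ ‖x‖| := by
  rw [(hasFDerivAt_comp_norm hψ h0 x).fderiv, norm_smul, Real.norm_eq_abs]
  exact mul_le_of_le_one_right (abs_nonneg _) (norm_fderiv_norm_le x)

theorem contDiff_one_comp_norm {ψ : ℝ → ℝ} (hψ : ContDiff ℝ 1 ψ) (h0 : deriv ψ 0 = 0) :
    ContDiff ℝ 1 (fun y : E => ψ ‖y‖) := by
  have hd : Differentiable ℝ ψ := hψ.differentiable one_ne_zero
  have hc : Continuous (deriv ψ) := hψ.continuous_deriv le_rfl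
  refine contDiff_one_iff_fderiv.2
    ⟨fun x => (hasFDerivAt_comp_norm hd h0 x).differentiableAt, ?_⟩
  refine continuous_iff_continuousAt.2 fun x => ?_
  by_cases hx : x = 0
  · subst hx
    have hz : fderiv ℝ (fun y : E => ψ ‖y‖) 0 = 0 := by
      simp [(hasFDerivAt_comp_norm hd h0 (0 : E)).fderiv, h0]
    rw [ContinuousAt, hz]
    refine squeeze_zero_norm (norm_fderiv_comp_norm_le hd h0) ?_
    have : Continuous fun y : E => |deriv ψ ‖y‖| := by fun_prop
    simpa [h0] using this.tendsto 0
  · have hcd : ContDiffAt ℝ 1 (fun y : E => ψ ‖y‖) x :=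
      hψ.contDiffAt.comp x (contDiffAt_norm ℝ hx)
    exact hcd.continuousAt_fderiv one_ne_zero

end RadialComposition

/-- A `C¹` contraction of `ℝ` fixing `0`, uniformly close to the identity and with a critical
point at a prescribed value `c`. -/
theorem exists_contraction_near_id (c : ℝ) {ε : ℝ} (hε : 0 < ε) :
    ∃ G : ℝ → ℝ, ContDiff ℝ 1 G ∧ deriv G c = 0 ∧ (∀ t, |deriv G t| ≤ 1) ∧
      (∀ t, |G t| ≤ |t|) ∧ ∀ t, |G t - t| ≤ ε * Real.pi := by
  let G : ℝ → ℝ := fun t => t - ε * (Real.arctan ((t - c) / ε) + Real.arctan (c / ε))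
  have hder (t : ℝ) : HasDerivAt G (1 - 1 / (1 + ((t - c) / ε) ^ 2)) t := by
    have h1 : HasDerivAt (fun t : ℝ => (t - c) / ε) (1 / ε) t :=
      ((hasDerivAt_id t).sub_const c).div_const ε
    refine ((hasDerivAt_id t).sub
      ((h1.arctan.add_const (Real.arctan (c / ε))).const_mul ε)).congr_deriv ?_
    field_simp
  have hle (t : ℝ) : |deriv G t| ≤ 1 := by
    rw [(hder t).deriv]
    have h1 : 0 < 1 / (1 + ((t - c) / ε) ^ 2) := by positivity
    have h2 : 1 / (1 + ((t - c) / ε) ^ 2) ≤ 1 := by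
      rw [div_le_one (by positivity)]
      nlinarith [sq_nonneg ((t - c) / ε)]
    rw [abs_le]
    constructor <;> linarith
  have hG0 : G 0 = 0 := by
    simp [G, neg_div, Real.arctan_neg]
  refine ⟨G, ?_, by simp [(hder c).deriv], hle, fun t => ?_, fun t => ?_⟩
  · have : ContDiff ℝ 1 fun t : ℝ => Real.arctan ((t - c) / ε) :=
      Real.contDiff_arctan.comp (by fun_prop)
    fun_prop
  · have := Convex.norm_image_sub_le_of_norm_deriv_le (f := G) (s := univ) (x := 0) (y := t) (C := 1)
      (fun x _ => (hder x).differentiableAt) (fun x _ => hle x) convex_univ trivial trivial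
    simpa [hG0] using this
  · have h1 := Real.arctan_lt_pi_div_two ((t - c) / ε)
    have h2 := Real.arctan_lt_pi_div_two (c / ε)
    have h3 := Real.neg_pi_div_two_lt_arctan ((t - c) / ε)
    have h4 := Real.neg_pi_div_two_lt_arctan (c / ε)
    have : G t - t = -(ε * (Real.arctan ((t - c) / ε) + Real.arctan (c / ε))) := by
      simp only [G]; ring
    rw [this, abs_neg, abs_mul, abs_of_pos hε]
    refine mul_le_mul_of_nonneg_left (abs_le.2 ⟨?_, ?_⟩) hε.le <;> linarith

section PolarCoordinates

variable {E : Type*} [NormedAddCommGroup E] [NormedSpace ℝ E] [FiniteDimensional ℝ E]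
  [MeasurableSpace E] [BorelSpace E] [Nontrivial E] (μ : Measure E) [μ.IsAddHaarMeasure]

theorem integral_eq_integral_polar (g : E → ℝ) :
    ∫ x, g x ∂μ = ∫ p : sphere (0 : E) 1 × Ioi (0 : ℝ), g ((p.2 : ℝ) • (p.1 : E))
      ∂(μ.toSphere.prod (Measure.volumeIoiPow (Module.finrank ℝ E - 1))) := by
  have hm : MeasurableSet ({0}ᶜ : Set E) := (measurableSet_singleton _).compl
  rw [← μ.measurePreserving_homeomorphUnitSphereProd.integral_comp
    (Homeomorph.measurableEmbedding _)]
  have (x : ({0}ᶜ : Set E)) : ((homeomorphUnitSphereProd E x).2 : ℝ) •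
      ((homeomorphUnitSphereProd E x).1 : E) = x :=
    congrArg Subtype.val ((homeomorphUnitSphereProd E).symm_apply_apply x)
  simp only [this]
  rw [integral_subtype_comap hm, restrict_compl_singleton]

theorem integrable_iff_integrable_polar (g : E → ℝ) :
    Integrable g μ ↔ Integrable
      (fun p : sphere (0 : E) 1 × Ioi (0 : ℝ) => g ((p.2 : ℝ) • (p.1 : E)))
      (μ.toSphere.prod (Measure.volumeIoiPow (Module.finrank ℝ E - 1))) := by
  have hm : MeasurableSet ({0}ᶜ : Set E) := (measurableSet_singleton _).compl
  rw [← μ.measurePreserving_homeomorphUnitSphereProd.integrable_comp_emb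
    (Homeomorph.measurableEmbedding _)]
  have (x : ({0}ᶜ : Set E)) : ((homeomorphUnitSphereProd E x).2 : ℝ) •
      ((homeomorphUnitSphereProd E x).1 : E) = x :=
    congrArg Subtype.val ((homeomorphUnitSphereProd E).symm_apply_apply x)
  simp only [Function.comp_def, this]
  have h := integrableOn_iff_comap_subtypeVal (f := g) (μ := μ) hm
  rwa [IntegrableOn, restrict_compl_singleton] at h

end PolarCoordinates

theorem norm_norm_smul {N : ℕ} {ω : Euc N} (hω : ‖ω‖ = 1) (x : Euc N) : ‖‖x‖ • ω‖ = ‖x‖ := by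
  simp [norm_smul, hω]

/-- The radial inequality passes to the profile of `w` along a ray. -/
theorem mul_integral_profile_le {N : ℕ} {q R : ℝ} (hq : 1 < q) (hR : 0 < R)
    {f : Euc N → ℝ} (hfm : Measurable f) {C : ℝ}
    (hyp : ∀ u : Euc N → ℝ, ContDiff ℝ 1 u → HasCompactSupport u →
      tsupport u ⊆ ball (0 : Euc N) R → IsRadial u →
      C * ∫ x in ball (0 : Euc N) R, |u x| ^ q * f x ≤
        ∫ x in ball (0 : Euc N) R, ‖fderiv ℝ u x‖ ^ q)
    {w : Euc N → ℝ} (hw1 : ContDiff ℝ 1 w) (hw3 : tsupport w ⊆ ball (0 : Euc N) R)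
    {ω : Euc N} (hω : ‖ω‖ = 1)
    (hint : IntegrableOn (fun x => |w (‖x‖ • ω)| ^ q * f x) (ball (0 : Euc N) R)) :
    C * ∫ x in ball (0 : Euc N) R, |w (‖x‖ • ω)| ^ q * f x ≤
      ∫ x in ball (0 : Euc N) R, |fderiv ℝ w (‖x‖ • ω) ω| ^ q := by
  have hq0 : 0 < q := by linarith
  obtain ⟨ρ, ⟨hρ0, hρR⟩, hρ⟩ := exists_pos_lt_subset_ball hR (isClosed_tsupport w) hw3
  have hwd : Differentiable ℝ w := hw1.differentiable one_ne_zero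
  have hwf : Continuous (fderiv ℝ w) := hw1.continuous_fderiv one_ne_zero
  have hwc : Continuous w := hw1.continuous
  choose G hG1 hGc hGd hGle hGid using fun n : ℕ =>
    exists_contraction_near_id (w 0) (Nat.one_div_pos_of_nat (α := ℝ) (n := n))
  have hφ (r : ℝ) : HasDerivAt (fun r : ℝ => w (r • ω)) (fderiv ℝ w (r • ω) ω) r := by
    have h1 : HasDerivAt (fun r : ℝ => r • ω) ω r := by
      simpa using (hasDerivAt_id r).smul_const ω
    exact (hwd (r • ω)).hasFDerivAt.comp_hasDerivAt r h1
  have hψ (n : ℕ) (r : ℝ) : HasDerivAt (fun r : ℝ => G n (w (r • ω)))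
      (deriv (G n) (w (r • ω)) * fderiv ℝ w (r • ω) ω) r :=
    (((hG1 n).differentiable one_ne_zero) _).hasDerivAt.comp r (hφ r)
  have hψ1 (n : ℕ) : ContDiff ℝ 1 (fun r : ℝ => G n (w (r • ω))) :=
    (hG1 n).comp (hw1.comp (by fun_prop))
  have hψ0 (n : ℕ) : deriv (fun r : ℝ => G n (w (r • ω))) 0 = 0 := by
    simp [(hψ n 0).deriv, hGc]
  have hsupp (n : ℕ) : tsupport (fun x : Euc N => G n (w (‖x‖ • ω))) ⊆ closedBall 0 ρ := by
    refine closure_minimal (fun x hx => ?_) isClosed_closedBall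
    by_contra hxρ
    have hz : w (‖x‖ • ω) = 0 := by
      refine image_eq_zero_of_notMem_tsupport fun hmem => hxρ ?_
      have := hρ hmem
      rw [mem_ball_zero_iff, norm_norm_smul hω] at this
      simpa using this.le
    have := hGle n (w (‖x‖ • ω))
    rw [hz, abs_zero] at this
    exact hx (by simpa [hz] using abs_nonpos_iff.1 this)
  have hI : IntegrableOn (fun x : Euc N => |fderiv ℝ w (‖x‖ • ω) ω| ^ q) (ball (0 : Euc N) R) := by
    have hcont : Continuous fun x : Euc N => |fderiv ℝ w (‖x‖ • ω) ω| ^ q :=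
      Continuous.rpow_const (by fun_prop) fun _ => Or.inr hq0.le
    exact (hcont.continuousOn.integrableOn_compact (isCompact_closedBall 0 R)).mono_set
      ball_subset_closedBall
  have hstep (n : ℕ) : C * ∫ x in ball (0 : Euc N) R, |G n (w (‖x‖ • ω))| ^ q * f x ≤
      ∫ x in ball (0 : Euc N) R, |fderiv ℝ w (‖x‖ • ω) ω| ^ q := by
    refine (hyp _ (contDiff_one_comp_norm (hψ1 n) (hψ0 n))
      ((isCompact_closedBall 0 ρ).of_isClosed_subset (isClosed_tsupport _) (hsupp n))
      ((hsupp n).trans (closedBall_subset_ball hρR))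
      (fun x y hxy => by simp only [hxy])).trans ?_
    refine integral_mono_of_nonneg (Eventually.of_forall fun x => by positivity) hI
      (Eventually.of_forall fun x => ?_)
    refine Real.rpow_le_rpow (norm_nonneg _) ?_ hq0.le
    refine (norm_fderiv_comp_norm_le ((hψ1 n).differentiable one_ne_zero) (hψ0 n) x).trans ?_
    rw [(hψ n ‖x‖).deriv, abs_mul]
    exact mul_le_of_le_one_left (abs_nonneg _) (hGd n _)
  suffices hT : Tendsto (fun n => ∫ x in ball (0 : Euc N) R, |G n (w (‖x‖ • ω))| ^ q * f x) atTop
      (nhds (∫ x in ball (0 : Euc N) R, |w (‖x‖ • ω)| ^ q * f x)) from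
    le_of_tendsto (hT.const_mul C) (Eventually.of_forall hstep)
  refine tendsto_integral_of_dominated_convergence (fun x => ‖|w (‖x‖ • ω)| ^ q * f x‖)
    (fun n => ?_) hint.norm (fun n => Eventually.of_forall fun x => ?_)
    (Eventually.of_forall fun x => ?_)
  · have hGn : Continuous (G n) := (hG1 n).continuous
    have hcont : Continuous fun x : Euc N => |G n (w (‖x‖ • ω))| ^ q :=
      Continuous.rpow_const (by fun_prop) fun _ => Or.inr hq0.le
    exact (hcont.measurable.mul hfm).aestronglyMeasurable
  · rw [norm_mul, norm_mul]
    refine mul_le_mul_of_nonneg_right ?_ (norm_nonneg _)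
    rw [Real.norm_of_nonneg (by positivity), Real.norm_of_nonneg (by positivity)]
    exact Real.rpow_le_rpow (abs_nonneg _) (hGle n _) hq0.le
  · have hlim : Tendsto (fun n => G n (w (‖x‖ • ω))) atTop (nhds (w (‖x‖ • ω))) := by
      rw [tendsto_iff_norm_sub_tendsto_zero]
      refine squeeze_zero (fun _ => norm_nonneg _) (fun n => hGid n _) ?_
      simpa using (tendsto_one_div_add_atTop_nhds_zero_nat (𝕜 := ℝ)).mul_const Real.pi
    exact (hlim.abs.rpow_const (Or.inr hq0.le)).mul_const _

end HS

/-- radial-to-general reduction lemma. -/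
theorem radial_to_general (N : ℕ) (q R : ℝ) (hN : 2 ≤ N) (hq : 1 < q) (hR : 0 < R)
    (f : HS.Euc N → ℝ) (hfm : Measurable f)
    (hf0 : ∀ x ∈ ball (0 : HS.Euc N) R, 0 ≤ f x)
    (hfrad : ∀ x y : HS.Euc N, x ∈ ball (0 : HS.Euc N) R → y ∈ ball (0 : HS.Euc N) R →
      ‖x‖ = ‖y‖ → f x = f y)
    (C : ℝ) (hC : 0 < C)
    (hyp : ∀ u : HS.Euc N → ℝ, ContDiff ℝ 1 u → HasCompactSupport u →
      tsupport u ⊆ ball (0 : HS.Euc N) R → HS.IsRadial u →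
      C * ∫ x in ball (0 : HS.Euc N) R, |u x| ^ q * f x ≤
        ∫ x in ball (0 : HS.Euc N) R, ‖fderiv ℝ u x‖ ^ q)
    (w : HS.Euc N → ℝ) (hw1 : ContDiff ℝ 1 w) (hw2 : HasCompactSupport w)
    (hw3 : tsupport w ⊆ ball (0 : HS.Euc N) R) :
    C * ∫ x in ball (0 : HS.Euc N) R, |w x| ^ q * f x ≤
      ∫ x in ball (0 : HS.Euc N) R, |fderiv ℝ w x (‖x‖⁻¹ • x)| ^ q := by
  have hq0 : 0 < q := by linarith
  have : Nonempty (Fin N) := ⟨⟨0, by omega⟩⟩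
  have hwc : Continuous w := hw1.continuous
  have hwf : Continuous (fderiv ℝ w) := hw1.continuous_fderiv one_ne_zero
  set σ := (volume : Measure (HS.Euc N)).toSphere with hσ
  set ν := Measure.volumeIoiPow (Module.finrank ℝ (HS.Euc N) - 1) with hν
  set F : HS.Euc N → ℝ := (ball (0 : HS.Euc N) R).indicator f with hF
  have hFrad (x y : HS.Euc N) (hxy : ‖x‖ = ‖y‖) : F x = F y := by
    by_cases hx : x ∈ ball (0 : HS.Euc N) R
    · have hy : y ∈ ball (0 : HS.Euc N) R := by simpa [← hxy] using hx
      rw [hF, indicator_of_mem hx, indicator_of_mem hy, hfrad x y hx hy hxy]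
    · have hy : y ∉ ball (0 : HS.Euc N) R := by simpa [← hxy] using hx
      rw [hF, indicator_of_notMem hx, indicator_of_notMem hy]
  have hmul (g : HS.Euc N → ℝ) : (ball (0 : HS.Euc N) R).indicator (fun x => g x * f x) =
      fun x => g x * F x := by
    ext x
    rw [indicator_mul_right]
  have hlhs (g : HS.Euc N → ℝ) :
      ∫ x in ball (0 : HS.Euc N) R, g x * f x = ∫ x, g x * F x := by
    rw [← integral_indicator measurableSet_ball, hmul]
  have hfd0 (x : HS.Euc N) (hx : x ∉ ball (0 : HS.Euc N) R) : fderiv ℝ w x = 0 :=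
    image_eq_zero_of_notMem_tsupport fun h => hx (hw3 (tsupport_fderiv_subset ℝ h))
  have hunit (p : sphere (0 : HS.Euc N) 1) : ‖(p : HS.Euc N)‖ = 1 := by simp
  have hnorm (p : sphere (0 : HS.Euc N) 1) (r : Ioi (0 : ℝ)) :
      ‖(r : ℝ) • (p : HS.Euc N)‖ = r := by
    rw [norm_smul, hunit, mul_one, Real.norm_of_nonneg (le_of_lt r.2)]
  rw [hlhs, setIntegral_eq_integral_of_forall_compl_eq_zero
    (fun x hx => by simp [hfd0 x hx, hq0.ne'])]
  rw [HS.integral_eq_integral_polar (volume : Measure (HS.Euc N)),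
    HS.integral_eq_integral_polar (volume : Measure (HS.Euc N))]
  simp only [hnorm, ← hσ, ← hν]
  have hray (p : sphere (0 : HS.Euc N) 1) (r : Ioi (0 : ℝ)) :
      (r : ℝ)⁻¹ • (r : ℝ) • (p : HS.Euc N) = p := inv_smul_smul₀ (ne_of_gt r.2) _
  simp only [hray]
  set A : sphere (0 : HS.Euc N) 1 × Ioi (0 : ℝ) → ℝ :=
    fun p => |w ((p.2 : ℝ) • (p.1 : HS.Euc N))| ^ q * F ((p.2 : ℝ) • (p.1 : HS.Euc N)) with hA
  set B : sphere (0 : HS.Euc N) 1 × Ioi (0 : ℝ) → ℝ :=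
    fun p => |fderiv ℝ w ((p.2 : ℝ) • (p.1 : HS.Euc N)) p.1| ^ q with hB
  have hBint : Integrable B (σ.prod ν) := by
    have h1 : Integrable fun x : HS.Euc N => ‖fderiv ℝ w x‖ ^ q := by
      refine Continuous.integrable_of_hasCompactSupport
        (Continuous.rpow_const (by fun_prop) fun _ => Or.inr hq0.le) ?_
      exact (hw2.fderiv ℝ).comp_left (g := fun L => ‖L‖ ^ q) (by simp [hq0.ne'])
    refine ((HS.integrable_iff_integrable_polar volume _).1 h1).mono' ?_
      (Eventually.of_forall fun p => ?_)
    · have : Continuous B := Continuous.rpow_const (by fun_prop) fun _ => Or.inr hq0.le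
      exact this.aestronglyMeasurable
    · rw [Real.norm_of_nonneg (by positivity)]
      refine Real.rpow_le_rpow (abs_nonneg _) ?_ hq0.le
      simpa [hunit] using (fderiv ℝ w ((p.2 : ℝ) • (p.1 : HS.Euc N))).le_opNorm p.1
  by_cases hAint : Integrable A (σ.prod ν)
  swap
  · rw [integral_undef hAint, mul_zero]
    exact integral_nonneg fun p => by positivity
  rw [integral_prod A hAint, integral_prod B hBint, ← integral_const_mul]
  refine integral_mono_ae (hAint.integral_prod_left.const_mul C) hBint.integral_prod_left ?_
  filter_upwards [hAint.prod_right_ae] with ω hωint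
  have hAω (p : sphere (0 : HS.Euc N) 1 × Ioi (0 : ℝ)) :
      |w ((p.2 : ℝ) • (ω : HS.Euc N))| ^ q * F ((p.2 : ℝ) • (p.1 : HS.Euc N)) = A (ω, p.2) := by
    rw [hA, hFrad ((p.2 : ℝ) • (p.1 : HS.Euc N)) ((p.2 : ℝ) • (ω : HS.Euc N))
      (by rw [hnorm, hnorm])]
  have hint : IntegrableOn (fun x : HS.Euc N => |w (‖x‖ • (ω : HS.Euc N))| ^ q * f x)
      (ball (0 : HS.Euc N) R) := by
    rw [← integrable_indicator_iff measurableSet_ball, hmul,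
      HS.integrable_iff_integrable_polar]
    simp only [hnorm, hAω]
    exact hωint.comp_snd σ
  have key := HS.mul_integral_profile_le hq hR hfm hyp hw1 hw3 (hunit ω) hint
  rw [hlhs, setIntegral_eq_integral_of_forall_compl_eq_zero (fun x hx => by
    rw [hfd0 _ (by simpa [HS.norm_norm_smul (hunit ω)] using hx)]; simp [hq0.ne']),
    HS.integral_eq_integral_polar (volume : Measure (HS.Euc N)),
    HS.integral_eq_integral_polar (volume : Measure (HS.Euc N))] at key
  simp only [hnorm, hAω, ← hσ, ← hν] at key
  rw [integral_fun_snd (fun r => A (ω, r)),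
    integral_fun_snd (fun r : Ioi (0 : ℝ) => |fderiv ℝ w ((r : ℝ) • (ω : HS.Euc N)) ω| ^ q),
    smul_eq_mul, smul_eq_mul, mul_left_comm] at key
  have : NeZero σ := ⟨Measure.toSphere_ne_zero _⟩
  have hσ0 : 0 < σ.real univ := measureReal_univ_pos
  exact le_of_mul_le_mul_left key hσ0
end
end

section
/- Infinite-dimensional form of the Sobolev inequality: Let 1 < p < N and let w ∈ C_c^1(ℝ^N) be radial with w not identically 0. For m > N set C_{m,p,0} = π^{p/2} · m · ((m−p)/(p−1))^{p−1} · (Γ(m/p) Γ(m+1−m/p)/(Γ(m) Γ(1+m/2)))^{p/m} and ω_{k−1} = k π^{k/2}/Γ(1+k/2). Then lim_{m→∞} C_{m,p,0} · (ω_{N−1}/ω_{m−1})^{p/m} · ((N−p)/(m−p))^{p − p/m} · (∫_{ℝ^N} |w(y)|^{mp/(m−p)} |y|^{−(m−N)p/(m−p)} dy)^{(m−p)/m} = ((N−p)/p)^p · ∫_{ℝ^N} |w(y)|^p |y|^{−p} dy. In particular, passing to the limit m → ∞ in the Sobolev inequality written in the form C_{m,p,0}(ω_{N−1}/ω_{m−1})^{p/m}((N−p)/(m−p))^{p−p/m}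 (∫_{ℝ^N}|w|^{mp/(m−p)}|y|^{−(m−N)p/(m−p)} dy)^{(m−p)/m} ≤ ∫_{ℝ^N}|∇w|^p dy (valid for radial w) yields the classical Hardy inequality ((N−p)/p)^p ∫_{ℝ^N}|w|^p|y|^{−p} dy ≤ ∫_{ℝ^N}|∇w|^p dy. -/
open MeasureTheory Metric Set Filter

noncomputable section

/-- The leading terms of Stirling's formula along the reals. -/
lemma tendsto_log_Gamma_div_sub_log :
    Tendsto (fun x : ℝ => Real.log (Real.Gamma x) / x - Real.log x) atTop (nhds (-1)) := by
  have hfl : Tendsto (fun x : ℝ => (⌊x⌋₊ : ℝ) / x) atTop (nhds 1) := tendsto_nat_floor_div_atTop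
  have hlog : Tendsto (fun x : ℝ => Real.log x / x) atTop (nhds 0) :=
    Real.isLittleO_log_id_atTop.tendsto_div_nhds_zero
  have hcast : Tendsto (fun n : ℕ => (n : ℝ)) atTop atTop := tendsto_natCast_atTop_atTop
  have hst : Tendsto (fun n : ℕ => (Real.log (Stirling.stirlingSeq n)
      + 1 / 2 * (Real.log 2 + Real.log n)) / n) atTop (nhds 0) := by
    have h1 : Tendsto (fun n : ℕ => Real.log (Stirling.stirlingSeq n) + 1 / 2 * Real.log 2)
        atTop (nhds (Real.log √Real.pi + 1 / 2 * Real.log 2)) :=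
      ((Stirling.tendsto_stirlingSeq_sqrt_pi).log (by positivity)).add tendsto_const_nhds
    have h2 := (h1.div_atTop hcast).add ((hlog.comp hcast).const_mul (1 / 2))
    simp only [mul_zero, add_zero] at h2
    refine h2.congr fun n => ?_
    simp only [Function.comp]
    ring
  have hfrac : Tendsto (fun x : ℝ => (1 - (⌊x⌋₊ : ℝ) / x) * Real.log x) atTop (nhds 0) := by
    refine tendsto_of_tendsto_of_tendsto_of_le_of_le' tendsto_const_nhds hlog ?_ ?_
    · filter_upwards [eventually_ge_atTop (1 : ℝ)] with x hx
      have h1 := Nat.floor_le (zero_le_one.trans hx)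
      have h2 : (⌊x⌋₊ : ℝ) / x ≤ 1 := (div_le_one (by linarith)).2 h1
      exact mul_nonneg (by linarith) (Real.log_nonneg hx)
    · filter_upwards [eventually_ge_atTop (1 : ℝ)] with x hx
      have h1 := Nat.lt_floor_add_one x
      have h2 : (1 - (⌊x⌋₊ : ℝ) / x) * Real.log x = (x - ⌊x⌋₊) * (Real.log x / x) := by
        field_simp
      rw [h2]
      have h3 : 0 ≤ Real.log x / x := div_nonneg (Real.log_nonneg hx) (by linarith)
      nlinarith
  have hgam : Tendsto (fun x : ℝ => (Real.log (Real.Gamma x) - Real.log (⌊x⌋₊.factorial : ℝ)) / x)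
      atTop (nhds 0) := by
    refine tendsto_of_tendsto_of_tendsto_of_le_of_le' (by simpa using hlog.neg)
      tendsto_const_nhds ?_ ?_
    · filter_upwards [eventually_ge_atTop (3 : ℝ)] with x hx
      have hx0 : 0 ≤ x := by linarith
      have hn : 3 ≤ ⌊x⌋₊ := Nat.le_floor (by exact_mod_cast hx)
      have hn' : (3 : ℝ) ≤ ⌊x⌋₊ := by exact_mod_cast hn
      have h1 := Nat.floor_le hx0
      have hmono : Real.Gamma (⌊x⌋₊ : ℝ) ≤ Real.Gamma x :=
        Real.Gamma_strictMonoOn_Ici.monotoneOn (by simp; linarith) (by simp; linarith) h1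
      have hpos : 0 < Real.Gamma (⌊x⌋₊ : ℝ) := Real.Gamma_pos_of_pos (by linarith)
      have h2 : (⌊x⌋₊.factorial : ℝ) = ⌊x⌋₊ * Real.Gamma (⌊x⌋₊ : ℝ) := by
        rw [← Real.Gamma_nat_eq_factorial, Real.Gamma_add_one (by linarith)]
      rw [h2, Real.log_mul (by linarith) hpos.ne', ← neg_div]
      have h3 := Real.log_le_log hpos hmono
      have h4 := Real.log_le_log (by linarith) h1
      gcongr
      linarith
    · filter_upwards [eventually_ge_atTop (3 : ℝ)] with x hx
      have hx0 : 0 ≤ x := by linarith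
      have h1 := (Nat.lt_floor_add_one x).le
      have hmono : Real.Gamma x ≤ Real.Gamma (⌊x⌋₊ + 1 : ℝ) :=
        Real.Gamma_strictMonoOn_Ici.monotoneOn (by simp; linarith) (by simp; linarith) h1
      rw [Real.Gamma_nat_eq_factorial] at hmono
      have h3 := Real.log_le_log (Real.Gamma_pos_of_pos (by linarith)) hmono
      exact div_nonpos_of_nonpos_of_nonneg (by linarith) hx0
  have hlogfl := hfl.log one_ne_zero
  have key := (((hgam.add ((hst.comp (tendsto_nat_floor_atTop (α := ℝ))).mul hfl)).sub hfl).add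
    (hfl.mul hlogfl)).sub hfrac
  simp only [Real.log_one, mul_one, mul_zero, add_zero, zero_sub, sub_zero] at key
  refine key.congr' ?_
  filter_upwards [eventually_ge_atTop (3 : ℝ)] with x hx
  have hx0 : 0 < x := by linarith
  have hn : 3 ≤ ⌊x⌋₊ := Nat.le_floor (by exact_mod_cast hx)
  have hn' : (0 : ℝ) < ⌊x⌋₊ := by exact_mod_cast (by omega : 0 < ⌊x⌋₊)
  have hs := Stirling.log_stirlingSeq_formula ⌊x⌋₊
  rw [Real.log_mul two_ne_zero hn'.ne', Real.log_div hn'.ne' (Real.exp_pos 1).ne',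
    Real.log_exp] at hs
  simp only [Function.comp, hs]
  rw [Real.log_div hn'.ne' hx0.ne']
  field_simp
  ring

lemma tendsto_div_sub_const_atTop (p : ℝ) :
    Tendsto (fun m : ℝ => m / (m - p)) atTop (nhds 1) := by
  have h : Tendsto (fun m : ℝ => 1 / (1 - p / m)) atTop (nhds (1 / (1 - 0))) :=
    tendsto_const_nhds.div (tendsto_const_nhds.sub (tendsto_const_nhds.div_atTop tendsto_id))
      (by norm_num)
  simp only [sub_zero, div_one] at h
  refine h.congr' ?_
  filter_upwards [eventually_gt_atTop 0, eventually_gt_atTop p] with m hm hmp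
  have : m - p ≠ 0 := by linarith
  field_simp

/-- The limit of Talenti's constant, normalised by the sphere area and the change of variables. -/
lemma tendsto_talenti_constant {p n A : ℝ} (hp : 1 < p) (hn : p < n) (hA : 0 < A) :
    Tendsto (fun m : ℝ => Real.pi ^ (p / 2) * m * ((m - p) / (p - 1)) ^ (p - 1) *
      ((Real.Gamma (m / p) * Real.Gamma (m + 1 - m / p)) /
        (Real.Gamma m * Real.Gamma (1 + m / 2))) ^ (p / m) *
      (A / (m * Real.pi ^ (m / 2) / Real.Gamma (1 + m / 2))) ^ (p / m) *
      ((n - p) / (m - p)) ^ (p - p / m)) atTop (nhds (((n - p) / p) ^ p)) := by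
  have hp0 : 0 < p := by linarith
  have hp1 : 0 < p - 1 := by linarith
  have hnp : 0 < n - p := by linarith
  set b : ℝ := (p - 1) / p with hb
  have hb0 : 0 < b := div_pos hp1 hp0
  set L : ℝ → ℝ := fun x => Real.log (Real.Gamma x) / x - Real.log x with hL
  have hLlim : Tendsto L atTop (nhds (-1)) := tendsto_log_Gamma_div_sub_log
  have hL1 : Tendsto (fun m : ℝ => L (m / p)) atTop (nhds (-1)) :=
    hLlim.comp (tendsto_id.atTop_div_const hp0)
  have hL2 : Tendsto (fun m : ℝ => L (b * m)) atTop (nhds (-1)) :=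
    hLlim.comp (tendsto_id.const_mul_atTop hb0)
  have hD : Tendsto (fun m : ℝ => Real.log (m / (m - p))) atTop (nhds 0) := by
    simpa using (tendsto_div_sub_const_atTop p).log one_ne_zero
  have hlog : Tendsto (fun x : ℝ => Real.log x / x) atTop (nhds 0) :=
    Real.isLittleO_log_id_atTop.tendsto_div_nhds_zero
  have hE : Tendsto (fun m : ℝ => p * ((Real.log b + Real.log A - Real.log (n - p)
      - Real.log (m / (m - p))) / m + Real.log m / m)) atTop (nhds 0) := by
    simpa using (((tendsto_const_nhds.sub hD).div_atTop tendsto_id).add hlog).const_mul p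
  have key := ((((hL1.add (hL2.const_mul (p - 1))).sub (hLlim.const_mul p)).add
    (tendsto_const_nhds (x := -Real.log p + (p - 1) * Real.log b - (p - 1) * Real.log (p - 1)
      + p * Real.log (n - p)))).add hD).add hE
  have hlim := (Real.continuous_exp.tendsto _).comp key
  have hval : Real.exp (-1 + (p - 1) * -1 - p * -1 + (-Real.log p + (p - 1) * Real.log b
      - (p - 1) * Real.log (p - 1) + p * Real.log (n - p)) + 0 + 0) = ((n - p) / p) ^ p := by
    rw [Real.rpow_def_of_pos (div_pos hnp hp0), Real.log_div hnp.ne' hp0.ne', hb,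
      Real.log_div hp1.ne' hp0.ne']
    congr 1
    ring
  rw [hval] at hlim
  clear_value b
  refine hlim.congr' ?_
  filter_upwards [eventually_gt_atTop p] with m hmp
  have hm : 0 < m := by linarith
  have hmp' : 0 < m - p := by linarith
  have hg1 : 0 < Real.Gamma (m / p) := Real.Gamma_pos_of_pos (by positivity)
  have hg2 : 0 < Real.Gamma (b * m) := Real.Gamma_pos_of_pos (by positivity)
  have hg3 : 0 < Real.Gamma m := Real.Gamma_pos_of_pos hm
  have hg4 : 0 < Real.Gamma (1 + m / 2) := Real.Gamma_pos_of_pos (by positivity)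
  have harg : m + 1 - m / p = b * m + 1 := by rw [hb]; field_simp; ring
  have hpi := Real.pi_pos
  rw [harg, Real.Gamma_add_one (by positivity)]
  simp only [Function.comp]
  refine Eq.trans (congrArg Real.exp ?_) (Real.exp_log ?_)
  · have e1 : Real.log (m / (m - p)) = Real.log m - Real.log (m - p) :=
      Real.log_div hm.ne' hmp'.ne'
    have e2 : Real.log (m / p) = Real.log m - Real.log p := Real.log_div hm.ne' hp0.ne'
    have e3 : Real.log (b * m) = Real.log b + Real.log m := Real.log_mul hb0.ne' hm.ne'
    simp only [hL, e1, e2, e3]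
    rw [Real.log_mul (by positivity) (by positivity), Real.log_mul (by positivity) (by positivity),
      Real.log_mul (by positivity) (by positivity), Real.log_mul (by positivity) (by positivity),
      Real.log_mul (by positivity) (by positivity),
      Real.log_rpow (by positivity), Real.log_rpow (by positivity), Real.log_rpow (by positivity),
      Real.log_rpow (by positivity), Real.log_rpow (by positivity),
      Real.log_div (by positivity) (by positivity), Real.log_div (by positivity) (by positivity),
      Real.log_div (by positivity) (by positivity), Real.log_div (by positivity) (by positivity),
      Real.log_div (by positivity) (by positivity),
      Real.log_mul (by positivity) (by positivity), Real.log_mul (by positivity) (by positivity),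
      Real.log_mul (by positivity) (by positivity), Real.log_mul (by positivity) (by positivity),
      Real.log_mul (by positivity) (by positivity), Real.log_rpow (by positivity)]
    have hb' : b * p = p - 1 := by rw [hb]; field_simp
    have hg : (p - 1) * (Real.log (Real.Gamma (b * m)) / (b * m))
        = p / m * Real.log (Real.Gamma (b * m)) := by
      rw [← hb']; field_simp
    rw [mul_sub (p - 1), hg]
    field_simp
    ring
  · positivity

lemma tendsto_hardy_integral {N : ℕ} {p : ℝ} (hp : 1 < p) (hpN : p < N)
    {w : HS.Euc N → ℝ} (hw1 : Continuous w) (hw2 : HasCompactSupport w) :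
    Tendsto (fun m : ℝ => ∫ y : HS.Euc N, |w y| ^ (m * p / (m - p)) *
        ‖y‖ ^ (-((m - (N : ℝ)) * p / (m - p)))) atTop
      (nhds (∫ y : HS.Euc N, |w y| ^ p * ‖y‖ ^ (-p))) := by
  have hp0 : 0 < p := by linarith
  have hN : 0 < N := by exact_mod_cast hp0.trans hpN
  have : Nonempty (Fin N) := ⟨⟨0, hN⟩⟩
  obtain ⟨R, hR⟩ := hw2.isCompact.isBounded.subset_ball (0 : HS.Euc N)
  obtain ⟨M, hM⟩ := hw2.exists_bound_of_continuous hw1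
  have hM0 : 0 ≤ M := (norm_nonneg _).trans (hM 0)
  have hq : Tendsto (fun m : ℝ => m * p / (m - p)) atTop (nhds p) := by
    have h := (tendsto_div_sub_const_atTop p).mul_const p
    rw [one_mul] at h
    exact h.congr fun m => by ring
  have hs : Tendsto (fun m : ℝ => -((m - (N : ℝ)) * p / (m - p))) atTop (nhds (-p)) := by
    have h1 : Tendsto (fun m : ℝ => N * p / (m - p)) atTop (nhds 0) :=
      tendsto_const_nhds.div_atTop (tendsto_atTop_add_const_right _ (-p) tendsto_id)
    have h := (hq.sub h1).neg
    rw [sub_zero] at h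
    exact h.congr fun m => by ring
  have hnorm : IntegrableOn (fun y : HS.Euc N => ‖y‖ ^ (-p)) (ball 0 R) := by
    refine integrableOn_ball_of_norm_le_rpow (C := 1) (α := p) ?_ ?_ ?_ ?_
    · rw [finrank_euclideanSpace_fin]; exact hN
    · rw [finrank_euclideanSpace_fin]; exact hpN
    · refine Eventually.of_forall fun y => ?_
      rw [one_mul, Real.norm_of_nonneg (by positivity)]
    · exact (measurable_norm.pow_const _).aestronglyMeasurable
  have hbound : Integrable ((ball (0 : HS.Euc N) R).indicator
      fun y => (1 + M) ^ (2 * p) * (‖y‖ ^ (-p) + 1)) := by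
    rw [integrable_indicator_iff measurableSet_ball]
    exact (hnorm.add (integrableOn_const (by finiteness))).const_mul _
  refine tendsto_integral_filter_of_dominated_convergence _ ?_ ?_ hbound ?_
  · refine Eventually.of_forall fun m => ?_
    exact ((hw1.abs.measurable.pow_const _).mul
      (measurable_norm.pow_const _)).aestronglyMeasurable
  · filter_upwards [eventually_gt_atTop (N : ℝ), eventually_ge_atTop (2 * p)] with m hmN hm2
    have hmp : 0 < m - p := by linarith
    have hq0 : 0 < m * p / (m - p) := by
      have : 0 < m := by linarith
      positivity
    have hq2 : m * p / (m - p) ≤ 2 * p := by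
      rw [div_le_iff₀ hmp]; nlinarith
    have hs0 : 0 ≤ (m - N) * p / (m - p) :=
      div_nonneg (mul_nonneg (by linarith) hp0.le) hmp.le
    have hsp : (m - N) * p / (m - p) ≤ p := by
      rw [div_le_iff₀ hmp]; nlinarith
    filter_upwards [compl_mem_ae_iff.2 (measure_singleton (0 : HS.Euc N))] with y hy
    have hy0 : 0 < ‖y‖ := norm_pos_iff.2 hy
    rw [Real.norm_of_nonneg (by positivity)]
    by_cases hyR : y ∈ ball (0 : HS.Euc N) R
    · rw [indicator_of_mem hyR]
      have hwM : |w y| ≤ 1 + M := (hM y).trans (by linarith)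
      have hwq : |w y| ^ (m * p / (m - p)) ≤ (1 + M) ^ (2 * p) :=
        (Real.rpow_le_rpow (abs_nonneg _) hwM hq0.le).trans
          (Real.rpow_le_rpow_of_exponent_le (by linarith) hq2)
      have hys : ‖y‖ ^ (-((m - (N : ℝ)) * p / (m - p))) ≤ ‖y‖ ^ (-p) + 1 := by
        rcases le_total ‖y‖ 1 with h | h
        · exact (Real.rpow_le_rpow_of_exponent_ge hy0 h (neg_le_neg hsp)).trans (by linarith)
        · have := Real.rpow_le_one_of_one_le_of_nonpos h (neg_nonpos.2 hs0)
          have : 0 ≤ ‖y‖ ^ (-p) := by positivity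
          linarith
      exact mul_le_mul hwq hys (by positivity) (by positivity)
    · have hwy : w y = 0 := image_eq_zero_of_notMem_tsupport fun h => hyR (hR h)
      rw [indicator_of_notMem hyR, hwy, abs_zero, Real.zero_rpow hq0.ne', zero_mul]
  · filter_upwards [compl_mem_ae_iff.2 (measure_singleton (0 : HS.Euc N))] with y hy
    exact (tendsto_const_nhds.rpow hq (Or.inr hp0)).mul
      (tendsto_const_nhds.rpow hs (Or.inl (norm_pos_iff.2 hy).ne'))

/-- infinite-dimensional form of the Sobolev inequality. -/
theorem infinite_dimensional_sobolev (N : ℕ) (p : ℝ) (hN : 2 ≤ N) (hp : 1 < p)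
    (hpN : p < (N : ℝ))
    (w : HS.Euc N → ℝ) (hw1 : ContDiff ℝ 1 w) (hw2 : HasCompactSupport w)
    (hwrad : HS.IsRadial w) (hwne : w ≠ 0) :
    let C : ℝ → ℝ := fun m => Real.pi ^ (p / 2) * m * ((m - p) / (p - 1)) ^ (p - 1) *
      ((Real.Gamma (m / p) * Real.Gamma (m + 1 - m / p)) /
        (Real.Gamma m * Real.Gamma (1 + m / 2))) ^ (p / m)
    let om : ℝ → ℝ := fun k => k * Real.pi ^ (k / 2) / Real.Gamma (1 + k / 2)
    let F : ℝ → ℝ := fun m => C m * (om (N : ℝ) / om m) ^ (p / m) *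
      (((N : ℝ) - p) / (m - p)) ^ (p - p / m) *
      (∫ y : HS.Euc N, |w y| ^ (m * p / (m - p)) *
        ‖y‖ ^ (-((m - (N : ℝ)) * p / (m - p)))) ^ ((m - p) / m)
    Tendsto F atTop
        (nhds ((((N : ℝ) - p) / p) ^ p * ∫ y : HS.Euc N, |w y| ^ p * ‖y‖ ^ (-p))) ∧
      ((∀ m : ℝ, (N : ℝ) < m → F m ≤ ∫ y : HS.Euc N, ‖fderiv ℝ w y‖ ^ p) →
        (((N : ℝ) - p) / p) ^ p * (∫ y : HS.Euc N, |w y| ^ p * ‖y‖ ^ (-p)) ≤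
          ∫ y : HS.Euc N, ‖fderiv ℝ w y‖ ^ p) := by
  intro C om F
  have hp0 : 0 < p := by linarith
  have hN0 : (0 : ℝ) < N := by linarith
  have hom : 0 < om N := by
    have := Real.Gamma_pos_of_pos (show 0 < 1 + (N : ℝ) / 2 by positivity)
    have := Real.pi_pos
    simp only [om]
    positivity
  have hexp : Tendsto (fun m : ℝ => (m - p) / m) atTop (nhds 1) := by
    have h := (tendsto_div_sub_const_atTop p).inv₀ one_ne_zero
    simpa only [inv_div, inv_one] using h
  have hlim : Tendsto F atTop
      (nhds ((((N : ℝ) - p) / p) ^ p * ∫ y : HS.Euc N, |w y| ^ p * ‖y‖ ^ (-p))) := by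
    have h := (tendsto_hardy_integral hp hpN hw1.continuous hw2).rpow hexp (Or.inr one_pos)
    rw [Real.rpow_one] at h
    exact (tendsto_talenti_constant hp hpN hom).mul h
  refine ⟨hlim, fun hF => le_of_tendsto hlim ?_⟩
  filter_upwards [eventually_gt_atTop (N : ℝ)] with m hm using hF m hm
end
end

section
/- Two nonlinear scalings behave differently on gradient norms: Let N ≥ 2, 1 < p < N, b ≥ 1, a ∈ [0,1], and let B_1 ⊂ ℝ^N be the open unit ball. For 0 < λ ≤ 1 and v ∈ C_c^1(B_1) define v_λ(x) = λ^{−(N−1)/N} v((|x|/b)^{λ−1} x); for λ ≥ 1 and w ∈ C_c^1(B_1) define w_λ(x) = λ^{(N−p)/p} w(λ [1 + a(λ^{(N−p)/(p−1)} − 1)|x|^{(N−p)/(p−1)}]^{−(p−1)/(N−p)} x). Then: (1) if v ∈ C_c^1(B_1) has angular gradient ∇_{S^{N−1}} v not identically zero, the sequence (v_{1/m})_{m≥1} is unbounded in W_0^{1,N}(B_1), i.e. ∫_{B_1}|∇ v_{1/m}(x)|^N dx → ∞ as m → ∞; (2) for every w ∈ C_c^1(B_1), the sequence (w_m)_{m≥1}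 is bounded in W_0^{1,p}(B_1), i.e. sup_{m≥1} ∫_{B_1}|∇ w_m(x)|^p dx < ∞. -/
open MeasureTheory Metric Set Filter

noncomputable section

section RadialScaling

open scoped RealInnerProductSpace

variable {E : Type*} [NormedAddCommGroup E] [InnerProductSpace ℝ E]

theorem fderiv_norm_apply_of_inner_eq_zero {x τ : E} (hx : x ≠ 0) (hτ : ⟪x, τ⟫ = 0) :
    fderiv ℝ (fun z : E => ‖z‖) x τ = 0 := by
  have hd : DifferentiableAt ℝ (fun z : E => ‖z‖) x := differentiableAt_id.norm ℝ hx
  have h1 := (hd.hasFDerivAt.pow 2).unique (hasStrictFDerivAt_norm_sq x).hasFDerivAt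
  have h2 := congrArg (fun L : E →L[ℝ] ℝ => L τ) h1
  simpa [hτ, hx] using h2

theorem hasFDerivAt_const_mul_comp_norm_smul {v : E → ℝ} {h : ℝ → ℝ} {h' k : ℝ} {x : E}
    (hx : x ≠ 0) (hh : HasDerivAt h h' ‖x‖) (hv : DifferentiableAt ℝ v (h ‖x‖ • x)) :
    HasFDerivAt (fun z => k * v (h ‖z‖ • z))
      (k • (fderiv ℝ v (h ‖x‖ • x)).comp (h ‖x‖ • ContinuousLinearMap.id ℝ E +
        (h' • fderiv ℝ (fun z : E => ‖z‖) x).smulRight x)) x := by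
  have hd : DifferentiableAt ℝ (fun z : E => ‖z‖) x := differentiableAt_id.norm ℝ hx
  have h1 : HasFDerivAt (fun z : E => h ‖z‖) (h' • fderiv ℝ (fun z : E => ‖z‖) x) x :=
    hh.comp_hasFDerivAt x hd.hasFDerivAt
  have h2 : HasFDerivAt (fun z : E => h ‖z‖ • z) (h ‖x‖ • ContinuousLinearMap.id ℝ E +
      (h' • fderiv ℝ (fun z : E => ‖z‖) x).smulRight x) x := h1.smul (hasFDerivAt_id x)
  have h3 : HasFDerivAt (fun z => v (h ‖z‖ • z)) _ x :=
    HasFDerivAt.comp (f := fun z : E => h ‖z‖ • z) x hv.hasFDerivAt h2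
  exact h3.const_mul k

theorem norm_fderiv_const_mul_comp_norm_smul_le {v : E → ℝ} {h : ℝ → ℝ} {h' k : ℝ} {x : E}
    (hx : x ≠ 0) (hh : HasDerivAt h h' ‖x‖) (hv : DifferentiableAt ℝ v (h ‖x‖ • x)) :
    ‖fderiv ℝ (fun z => k * v (h ‖z‖ • z)) x‖ ≤
      |k| * (‖fderiv ℝ v (h ‖x‖ • x)‖ * (|h ‖x‖| + |h'| * ‖x‖)) := by
  rw [(hasFDerivAt_const_mul_comp_norm_smul hx hh hv).fderiv, norm_smul, Real.norm_eq_abs]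
  refine mul_le_mul_of_nonneg_left ((ContinuousLinearMap.opNorm_comp_le _ _).trans ?_)
    (abs_nonneg _)
  refine mul_le_mul_of_nonneg_left ((norm_add_le _ _).trans (add_le_add ?_ ?_)) (norm_nonneg _)
  · rw [norm_smul, Real.norm_eq_abs]
    exact mul_le_of_le_one_right (abs_nonneg _) ContinuousLinearMap.norm_id_le
  · rw [ContinuousLinearMap.norm_smulRight_apply, norm_smul, Real.norm_eq_abs]
    have h1 : ‖fderiv ℝ (fun z : E => ‖z‖) x‖ ≤ 1 := by
      simpa using norm_fderiv_le_of_lipschitz ℝ (lipschitzWith_one_norm (E := E)) (x₀ := x)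
    exact mul_le_mul_of_nonneg_right (mul_le_of_le_one_right (abs_nonneg _) h1) (norm_nonneg _)

theorem fderiv_const_mul_comp_norm_smul_apply_of_inner_eq_zero {v : E → ℝ} {h : ℝ → ℝ}
    {h' k : ℝ} {x τ : E} (hx : x ≠ 0) (hh : HasDerivAt h h' ‖x‖)
    (hv : DifferentiableAt ℝ v (h ‖x‖ • x)) (hτ : ⟪x, τ⟫ = 0) :
    fderiv ℝ (fun z => k * v (h ‖z‖ • z)) x τ =
      k * (h ‖x‖ * fderiv ℝ v (h ‖x‖ • x) τ) := by
  rw [(hasFDerivAt_const_mul_comp_norm_smul hx hh hv).fderiv]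
  simp [fderiv_norm_apply_of_inner_eq_zero hx hτ]

theorem fderiv_const_mul_comp_norm_smul_eq_zero {v : E → ℝ} {h : ℝ → ℝ} {h' k : ℝ} {x : E}
    (hx : x ≠ 0) (hh : HasDerivAt h h' ‖x‖) (hv : h ‖x‖ • x ∉ tsupport v) :
    fderiv ℝ (fun z => k * v (h ‖z‖ • z)) x = 0 := by
  have h0 := HasFDerivAt.of_notMem_tsupport ℝ hv
  rw [(hasFDerivAt_const_mul_comp_norm_smul hx hh h0.differentiableAt).fderiv, h0.fderiv]
  simp

end RadialScaling

theorem Real.hasDerivAt_mul_one_add_mul_rpow_rpow {α γ A L t : ℝ} (hA : 0 ≤ A) (ht : 0 < t) :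
    HasDerivAt (fun t : ℝ => L * (1 + A * t ^ α) ^ (-γ))
      (L * (A * (α * t ^ (α - 1)) * (-γ) * (1 + A * t ^ α) ^ (-γ - 1))) t := by
  have hpos : 0 < 1 + A * t ^ α := by positivity
  have h1 := ((Real.hasDerivAt_rpow_const (p := α) (Or.inl ht.ne')).const_mul A).const_add 1
  exact (h1.rpow_const (Or.inl hpos.ne')).const_mul L

theorem Real.abs_deriv_mul_one_add_mul_rpow_rpow_mul_le {α γ A L t : ℝ} (hA : 0 ≤ A)
    (hL : 0 ≤ L) (hα : 0 < α) (hαγ : α * γ = 1) (ht : 0 < t) :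
    |L * (A * (α * t ^ (α - 1)) * (-γ) * (1 + A * t ^ α) ^ (-γ - 1))| * t ≤
      L * (1 + A * t ^ α) ^ (-γ) := by
  have hpos : 0 < 1 + A * t ^ α := by positivity
  have hγ : 0 < γ := pos_of_mul_pos_right (by rw [hαγ]; exact one_pos) hα.le
  have e1 : L * (A * (α * t ^ (α - 1)) * (-γ) * (1 + A * t ^ α) ^ (-γ - 1)) =
      -(L * ((1 + A * t ^ α) ^ (-γ) * (A * t ^ (α - 1) / (1 + A * t ^ α)))) := by
    rw [Real.rpow_sub_one hpos.ne']
    linear_combination (-L * A * t ^ (α - 1) * ((1 + A * t ^ α) ^ (-γ) / (1 + A * t ^ α))) * hαγ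
  rw [e1, abs_neg, abs_of_nonneg (by positivity), mul_assoc, mul_assoc]
  refine mul_le_mul_of_nonneg_left (mul_le_of_le_one_right (by positivity) ?_) hL
  rw [Real.rpow_sub_one ht.ne', div_mul_eq_mul_div, div_le_one hpos]
  field_simp
  linarith

theorem Real.mul_le_of_mul_one_add_mul_rpow_rpow_mul_le {α γ A L t ρ : ℝ} (hA : 0 ≤ A)
    (hL : 1 ≤ L) (hAL : A ≤ L ^ α) (hα : 0 < α) (hαγ : α * γ = 1) (ht : 0 < t)
    (hρ0 : 0 < ρ) (hρ1 : ρ < 1) (hle : L * (1 + A * t ^ α) ^ (-γ) * t ≤ ρ) :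
    L * t ≤ (ρ ^ α / (1 - ρ ^ α)) ^ α⁻¹ := by
  have hL0 : 0 < L := by linarith
  have hpos : 0 < 1 + A * t ^ α := by positivity
  have hρα : ρ ^ α < 1 := Real.rpow_lt_one hρ0.le hρ1 hα
  have h1 := Real.rpow_le_rpow (by positivity) hle hα.le
  have e : (L * (1 + A * t ^ α) ^ (-γ) * t) ^ α = (L * t) ^ α / (1 + A * t ^ α) := by
    rw [mul_right_comm, Real.mul_rpow (by positivity) (by positivity), ← Real.rpow_mul hpos.le,
      show -γ * α = -1 by linarith, Real.rpow_neg_one, div_eq_mul_inv]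
  rw [e, div_le_iff₀ hpos] at h1
  have h2 : A * t ^ α ≤ (L * t) ^ α := by
    rw [Real.mul_rpow hL0.le ht.le]
    gcongr
  have hρα0 : 0 < ρ ^ α := by positivity
  have h3 : (L * t) ^ α ≤ ρ ^ α / (1 - ρ ^ α) := by
    rw [le_div_iff₀ (by linarith)]
    nlinarith
  calc L * t = ((L * t) ^ α) ^ α⁻¹ := (Real.rpow_rpow_inv (by positivity) hα.ne').symm
    _ ≤ _ := Real.rpow_le_rpow (by positivity) h3 (by positivity)

/-- If `|f| ≤ C L^{d/p}` holds a.e. and `f` vanishes a.e. outside the ball of radius `K / L`,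
then the integral of `|f|^p` is bounded independently of `L`. -/
theorem setIntegral_norm_rpow_le_of_concentrated {N : ℕ} {F : Type*} [NormedAddCommGroup F]
    {f : HS.Euc N → F} {s : Set (HS.Euc N)} {p C K L : ℝ} (hp : 0 < p) (hC : 0 ≤ C) (hK : 0 ≤ K)
    (hL : 0 < L) (hf : ∀ᵐ x, ‖f x‖ ≤ C * L ^ ((N : ℝ) / p))
    (hf0 : ∀ᵐ x, K / L < ‖x‖ → f x = 0) :
    ∫ x in s, ‖f x‖ ^ p ≤
      C ^ p * K ^ N * volume.real (ball (0 : HS.Euc N) 1) := by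
  set D := closedBall (0 : HS.Euc N) (K / L)
  have hD : volume D ≠ ⊤ := measure_closedBall_lt_top.ne
  have hint : Integrable (D.indicator fun _ => C ^ p * L ^ N) volume :=
    (integrable_indicator_iff measurableSet_closedBall).2 (integrableOn_const hD)
  have hbd : ∀ᵐ x, ‖f x‖ ^ p ≤ D.indicator (fun _ => C ^ p * L ^ N) x := by
    filter_upwards [hf, hf0] with x h1 h2
    by_cases hx : x ∈ D
    · rw [indicator_of_mem hx]
      calc ‖f x‖ ^ p ≤ (C * L ^ ((N : ℝ) / p)) ^ p :=
            Real.rpow_le_rpow (norm_nonneg _) h1 hp.le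
        _ = C ^ p * L ^ N := by
            rw [Real.mul_rpow hC (by positivity), ← Real.rpow_mul hL.le,
              div_mul_cancel₀ _ hp.ne', Real.rpow_natCast]
    · rw [indicator_of_notMem hx, h2 (by simpa [D] using hx)]
      simp [Real.zero_rpow hp.ne']
  calc ∫ x in s, ‖f x‖ ^ p
      ≤ ∫ x in s, D.indicator (fun _ => C ^ p * L ^ N) x :=
        integral_mono_of_nonneg (.of_forall fun x => by positivity) hint.integrableOn
          (ae_restrict_of_ae hbd)
    _ ≤ ∫ x, D.indicator (fun _ => C ^ p * L ^ N) x :=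
        setIntegral_le_integral hint
          (.of_forall fun x => indicator_nonneg (fun _ _ => by positivity) x)
    _ = C ^ p * K ^ N * volume.real (ball (0 : HS.Euc N) 1) := by
        rw [integral_indicator measurableSet_closedBall, setIntegral_const,
          Measure.addHaar_real_closedBall _ _ (by positivity)]
        simp only [finrank_euclideanSpace, Fintype.card_fin, smul_eq_mul, div_pow]
        field_simp

theorem exists_setIntegral_norm_fderiv_virtual_scaling_le {N : ℕ} {p a : ℝ} (hN : 2 ≤ N)
    (hp : 1 < p) (hpN : p < (N : ℝ)) (ha : a ∈ Icc (0 : ℝ) 1) {w : HS.Euc N → ℝ}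
    (hw : ContDiff ℝ 1 w) (hwc : HasCompactSupport w)
    (hws : tsupport w ⊆ ball (0 : HS.Euc N) 1) :
    ∃ M : ℝ, ∀ L : ℝ, 1 ≤ L →
      (∫ x in ball (0 : HS.Euc N) 1,
        ‖fderiv ℝ (fun z : HS.Euc N => L ^ (((N : ℝ) - p) / p) *
          w ((L * (1 + a * (L ^ (((N : ℝ) - p) / (p - 1)) - 1) *
            ‖z‖ ^ (((N : ℝ) - p) / (p - 1))) ^ (-((p - 1) / ((N : ℝ) - p)))) • z)) x‖ ^ p) ≤ M := by
  have : Nontrivial (HS.Euc N) := by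
    apply Module.nontrivial_of_finrank_pos (R := ℝ)
    simp; omega
  obtain ⟨C, hC⟩ := (hw.continuous_fderiv one_ne_zero).bounded_above_of_compact_support
    (hwc.fderiv ℝ)
  have hC0 : 0 ≤ C := (norm_nonneg _).trans (hC 0)
  obtain ⟨ρ, hρ, hsρ⟩ := exists_pos_lt_subset_ball one_pos (isClosed_tsupport w) hws
  set α : ℝ := ((N : ℝ) - p) / (p - 1) with hα_def
  set γ : ℝ := (p - 1) / ((N : ℝ) - p) with hγ_def
  have hNp : 0 < (N : ℝ) - p := by linarith
  have hp1 : 0 < p - 1 := by linarith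
  have hα : 0 < α := by positivity
  have hαγ : α * γ = 1 := by rw [hα_def, hγ_def]; field_simp
  have hρα : ρ ^ α < 1 := Real.rpow_lt_one hρ.1.le hρ.2 hα
  have hK : 0 ≤ ρ ^ α / (1 - ρ ^ α) :=
    div_nonneg (Real.rpow_nonneg hρ.1.le _) (by linarith)
  refine ⟨(2 * C) ^ p * ((ρ ^ α / (1 - ρ ^ α)) ^ α⁻¹) ^ N *
    volume.real (ball (0 : HS.Euc N) 1), fun L hL => ?_⟩
  have hL0 : 0 < L := by linarith
  have hLα : 1 ≤ L ^ α := Real.one_le_rpow hL hα.le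
  set A : ℝ := a * (L ^ α - 1) with hA_def
  have hA : 0 ≤ A := mul_nonneg ha.1 (by linarith)
  have hAL : A ≤ L ^ α := by nlinarith [ha.1, ha.2]
  have hne : ∀ᵐ x : HS.Euc N, x ≠ 0 := by
    simp [ae_iff]
  refine setIntegral_norm_rpow_le_of_concentrated (L := L) (by linarith) (by positivity)
    (Real.rpow_nonneg hK _) hL0 ?_ ?_
  · filter_upwards [hne] with x hx
    have ht : 0 < ‖x‖ := norm_pos_iff.2 hx
    refine (norm_fderiv_const_mul_comp_norm_smul_le
      (h := fun t => L * (1 + A * t ^ α) ^ (-γ)) hx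
      (Real.hasDerivAt_mul_one_add_mul_rpow_rpow hA ht)
      (hw.differentiable one_ne_zero _)).trans ?_
    have h1 := Real.abs_deriv_mul_one_add_mul_rpow_rpow_mul_le hA hL0.le hα hαγ ht
    have hγ : 0 < γ := by positivity
    have h2 : (1 + A * ‖x‖ ^ α) ^ (-γ) ≤ 1 :=
      Real.rpow_le_one_of_one_le_of_nonpos (le_add_of_nonneg_right (by positivity)) (by linarith)
    have h3 : L * (1 + A * ‖x‖ ^ α) ^ (-γ) ≤ L := mul_le_of_le_one_right hL0.le h2
    rw [abs_of_nonneg (by positivity : 0 ≤ L ^ (((N : ℝ) - p) / p)),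
      abs_of_nonneg (by positivity : 0 ≤ L * (1 + A * ‖x‖ ^ α) ^ (-γ))]
    calc L ^ (((N : ℝ) - p) / p) * (_ * _) ≤ L ^ (((N : ℝ) - p) / p) * (C * (2 * L)) := by
          gcongr
          · exact hC _
          · linarith
      _ = 2 * C * (L ^ (((N : ℝ) - p) / p) * L ^ (1 : ℝ)) := by rw [Real.rpow_one]; ring
      _ = 2 * C * L ^ ((N : ℝ) / p) := by
          rw [← Real.rpow_add hL0]
          congr 2
          field_simp
          ring
  · filter_upwards [hne] with x hx hKx
    have ht : 0 < ‖x‖ := norm_pos_iff.2 hx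
    refine fderiv_const_mul_comp_norm_smul_eq_zero
      (h := fun t => L * (1 + A * t ^ α) ^ (-γ)) hx
      (Real.hasDerivAt_mul_one_add_mul_rpow_rpow hA ht) fun hmem => ?_
    have hb := hsρ hmem
    rw [mem_ball_zero_iff, norm_smul, Real.norm_of_nonneg (by positivity)] at hb
    have h1 := Real.mul_le_of_mul_one_add_mul_rpow_rpow_mul_le hA hL hAL hα hαγ ht hρ.1 hρ.2 hb.le
    rw [div_lt_iff₀ hL0] at hKx
    linarith

theorem Real.hasDerivAt_div_rpow {b l t : ℝ} (hb : 0 < b) (ht : 0 < t) :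
    HasDerivAt (fun t : ℝ => (t / b) ^ (l - 1)) ((l - 1) * (t / b) ^ (l - 1) / t) t := by
  have h := (((hasDerivAt_id' t).div_const b).rpow_const (p := l - 1)
    (Or.inl (div_pos ht hb).ne'))
  rw [Real.rpow_sub_one (div_pos ht hb).ne' (l - 1)] at h
  refine h.congr_deriv ?_
  field_simp

theorem Real.exists_div_rpow_mul_eq {b l ρ : ℝ} (hb : 1 ≤ b) (hl : 0 < l) (hl1 : l ≤ 1)
    (hρ : 0 < ρ) (hρ1 : ρ < 1) : ∃ t, 0 < t ∧ t < 1 ∧ (t / b) ^ (l - 1) * t = ρ := by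
  have hb0 : 0 < b := by linarith
  have hbl : b ^ (l - 1) ≤ 1 := Real.rpow_le_one_of_one_le_of_nonpos hb (by linarith)
  refine ⟨(ρ * b ^ (l - 1)) ^ l⁻¹, by positivity,
    Real.rpow_lt_one (by positivity) (by nlinarith) (by positivity), ?_⟩
  have ht : 0 < (ρ * b ^ (l - 1)) ^ l⁻¹ := by positivity
  rw [Real.div_rpow ht.le hb0.le, div_mul_eq_mul_div, ← Real.rpow_add_one ht.ne', sub_add_cancel,
    Real.rpow_inv_rpow (by positivity) hl.ne']
  field_simp

section AngularGradient

open scoped RealInnerProductSpace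

theorem exists_inner_eq_zero_fderiv_pos {E : Type*} [NormedAddCommGroup E]
    [InnerProductSpace ℝ E] [CompleteSpace E] {v : E → ℝ} {y : E} (hy : y ≠ 0)
    (hv : gradient v y ≠ (fderiv ℝ v y (‖y‖⁻¹ • y)) • (‖y‖⁻¹ • y)) :
    ∃ e : E, ⟪y, e⟫ = 0 ∧ 0 < fderiv ℝ v y e := by
  have hn : ‖y‖ ≠ 0 := norm_ne_zero_iff.2 hy
  have hg : ∀ u : E, fderiv ℝ v y u = ⟪gradient v y, u⟫ := fun u => by simp [gradient]
  set g := gradient v y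
  set e := g - (fderiv ℝ v y (‖y‖⁻¹ • y)) • (‖y‖⁻¹ • y) with he
  have hye : ⟪y, e⟫ = 0 := by
    rw [he, hg]
    simp only [inner_sub_right, inner_smul_right, real_inner_self_eq_norm_sq]
    rw [real_inner_comm]
    field_simp
    ring
  refine ⟨e, hye, ?_⟩
  have h1 : ⟪g, e⟫ = ⟪e, e⟫ := by
    nth_rewrite 2 [he]
    rw [inner_sub_left, inner_smul_left, inner_smul_left, hye]
    simp
  rw [hg, h1]
  exact real_inner_self_pos.2 (sub_ne_zero.2 hv)

theorem exists_pos_le_fderiv_tangential {E : Type*} [NormedAddCommGroup E]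
    [InnerProductSpace ℝ E] {v : E → ℝ} (hv : ContDiff ℝ 1 v) {y e : E} (hy : y ≠ 0)
    (hye : ⟪y, e⟫ = 0) (he : 0 < fderiv ℝ v y e) :
    ∃ c > 0, ∃ δ > 0, ∀ z, ‖z - y‖ < δ →
      c ≤ fderiv ℝ v z (‖z‖ ^ 2 • e - ⟪z, e⟫ • z) := by
  have hc : Continuous fun z => fderiv ℝ v z (‖z‖ ^ 2 • e - ⟪z, e⟫ • z) :=
    (hv.continuous_fderiv one_ne_zero).clm_apply (by fun_prop)
  have h0 : 0 < fderiv ℝ v y (‖y‖ ^ 2 • e - ⟪y, e⟫ • y) := by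
    have : 0 < ‖y‖ := norm_pos_iff.2 hy
    simp only [hye, zero_smul, sub_zero, map_smul, smul_eq_mul]
    positivity
  obtain ⟨δ, hδ, h⟩ := Metric.eventually_nhds_iff.1
    (hc.continuousAt.eventually (lt_mem_nhds (half_lt_self h0)))
  exact ⟨_, half_pos h0, δ, hδ, fun z hz => (h (by rwa [dist_eq_norm])).le⟩

theorem le_norm_fderiv_const_mul_comp_norm_smul {E : Type*} [NormedAddCommGroup E]
    [InnerProductSpace ℝ E] {v : E → ℝ} {h : ℝ → ℝ} {h' k c : ℝ} {x e : E}
    (hx : x ≠ 0) (hh : HasDerivAt h h' ‖x‖) (hv : DifferentiableAt ℝ v (h ‖x‖ • x))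
    (hk : 0 ≤ k) (hh0 : 0 ≤ h ‖x‖) (he : e ≠ 0) (hy : ‖h ‖x‖ • x‖ ≤ 1)
    (hc : c ≤ fderiv ℝ v (h ‖x‖ • x)
      (‖h ‖x‖ • x‖ ^ 2 • e - ⟪h ‖x‖ • x, e⟫ • (h ‖x‖ • x))) :
    k * h ‖x‖ * (c / (2 * ‖e‖)) ≤ ‖fderiv ℝ (fun z => k * v (h ‖z‖ • z)) x‖ := by
  set y := h ‖x‖ • x with hy_def
  set τ := ‖y‖ ^ 2 • e - ⟪y, e⟫ • y with hτ_def
  have he0 : 0 < ‖e‖ := norm_pos_iff.2 he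
  have hτ : ⟪x, τ⟫ = 0 := by
    simp only [hτ_def, hy_def, inner_sub_right, inner_smul_right, inner_smul_left, norm_smul,
      real_inner_self_eq_norm_sq, mul_pow, Real.norm_eq_abs, sq_abs]
    simp
    ring
  have hτn : ‖τ‖ ≤ 2 * ‖e‖ := by
    calc ‖τ‖ ≤ ‖‖y‖ ^ 2 • e‖ + ‖⟪y, e⟫ • y‖ := norm_sub_le _ _
      _ ≤ ‖y‖ ^ 2 * ‖e‖ + (‖y‖ * ‖e‖) * ‖y‖ := by
        rw [norm_smul _ e, norm_smul _ y, norm_pow, norm_norm]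
        gcongr
        exact norm_inner_le_norm y e
      _ = 2 * ‖e‖ * ‖y‖ ^ 2 := by ring
      _ ≤ 2 * ‖e‖ * 1 := by gcongr; exact pow_le_one₀ (norm_nonneg _) hy
      _ = 2 * ‖e‖ := mul_one _
  have h1 := (fderiv ℝ (fun z => k * v (h ‖z‖ • z)) x).le_opNorm τ
  rw [fderiv_const_mul_comp_norm_smul_apply_of_inner_eq_zero hx hh hv hτ] at h1
  rw [← mul_div_assoc, div_le_iff₀ (by positivity)]
  calc k * h ‖x‖ * c ≤ k * (h ‖x‖ * fderiv ℝ v y τ) := by rw [mul_assoc]; gcongr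
    _ ≤ _ := le_abs_self _
    _ ≤ _ := h1
    _ ≤ _ := by gcongr

end AngularGradient

theorem norm_rpow_smul_sub_lt {E : Type*} [NormedAddCommGroup E] [NormedSpace ℝ E] {y z : E}
    {l ε : ℝ} (hl : 0 < l) (hl1 : l ≤ 1) (hz0 : z ≠ 0) (hz : ‖z‖ ≤ 1)
    (hzy : ‖‖y‖ • z - y‖ < ε) : ‖(‖y‖ * ‖z‖ ^ (l - 1)) • z - y‖ < 2 * ε := by
  have hzp : 0 < ‖z‖ := norm_pos_iff.2 hz0
  have h1 : 1 ≤ ‖z‖ ^ (l - 1) := Real.one_le_rpow_of_pos_of_le_one_of_nonpos hzp hz (by linarith)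
  have h2 : ‖z‖ ^ (l - 1) * ‖z‖ ≤ 1 := by
    rw [← Real.rpow_add_one hzp.ne', sub_add_cancel]
    exact Real.rpow_le_one hzp.le hz hl.le
  have h3 : ‖y‖ - ‖y‖ * ‖z‖ < ε := by
    have := norm_sub_norm_le y (‖y‖ • z)
    rw [norm_sub_rev, norm_smul, norm_norm] at this
    linarith
  have e : (‖y‖ * ‖z‖ ^ (l - 1)) • z - y =
      (‖y‖ • z - y) + (‖y‖ * (‖z‖ ^ (l - 1) - 1)) • z := by module
  calc _ ≤ ‖‖y‖ • z - y‖ + ‖(‖y‖ * (‖z‖ ^ (l - 1) - 1)) • z‖ := by rw [e]; exact norm_add_le _ _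
    _ = ‖‖y‖ • z - y‖ + ‖y‖ * (‖z‖ ^ (l - 1) * ‖z‖ - ‖z‖) := by
      rw [norm_smul, Real.norm_of_nonneg (mul_nonneg (norm_nonneg _) (by linarith))]
      ring
    _ < 2 * ε := by nlinarith [norm_nonneg y]

theorem integrableOn_norm_fderiv_power_scaling {N : ℕ} {b k l : ℝ} (hN : 1 ≤ N) (hb : 0 < b)
    (hl : 0 < l) (hl1 : l ≤ 1) {v : HS.Euc N → ℝ} (hv : ContDiff ℝ 1 v)
    (hvc : HasCompactSupport v) :
    IntegrableOn (fun x => ‖fderiv ℝ (fun z : HS.Euc N =>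
      k * v (((‖z‖ / b) ^ (l - 1)) • z)) x‖ ^ (N : ℝ)) (ball (0 : HS.Euc N) 1) := by
  have : Nontrivial (HS.Euc N) := by
    apply Module.nontrivial_of_finrank_pos (R := ℝ)
    simp; omega
  have hN0 : (0 : ℝ) < N := by exact_mod_cast hN
  obtain ⟨C, hC⟩ := (hv.continuous_fderiv one_ne_zero).bounded_above_of_compact_support
    (hvc.fderiv ℝ)
  have hC0 : 0 ≤ C := (norm_nonneg _).trans (hC 0)
  have hne : ∀ᵐ x : HS.Euc N, x ≠ 0 := by simp [ae_iff]
  refine integrableOn_ball_of_norm_le_rpow (C := (|k| * (C * (2 * (b ^ (l - 1))⁻¹))) ^ (N : ℝ))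
    (α := N * (1 - l)) (by simpa using hN) (by simp; nlinarith) (ae_restrict_of_ae ?_)
    ((measurable_fderiv ℝ _).norm.pow_const _).aestronglyMeasurable
  filter_upwards [hne] with x hx
  have ht : 0 < ‖x‖ := norm_pos_iff.2 hx
  have h1 := norm_fderiv_const_mul_comp_norm_smul_le (k := k)
    (h := fun t => (t / b) ^ (l - 1)) hx
    (Real.hasDerivAt_div_rpow hb ht) (hv.differentiable one_ne_zero _)
  have hp : 0 < (‖x‖ / b) ^ (l - 1) := by positivity
  have h2 : |(‖x‖ / b) ^ (l - 1)| + |(l - 1) * (‖x‖ / b) ^ (l - 1) / ‖x‖| * ‖x‖ ≤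
      2 * (‖x‖ / b) ^ (l - 1) := by
    rw [abs_div, abs_mul, abs_of_pos hp, abs_of_pos ht, div_mul_cancel₀ _ ht.ne',
      abs_of_nonpos (by linarith : l - 1 ≤ 0)]
    nlinarith
  have h3 : ‖fderiv ℝ (fun z : HS.Euc N => k * v (((‖z‖ / b) ^ (l - 1)) • z)) x‖ ≤
      |k| * (C * (2 * (b ^ (l - 1))⁻¹)) * ‖x‖ ^ (l - 1) := by
    refine h1.trans ?_
    calc _ ≤ |k| * (C * (2 * (‖x‖ / b) ^ (l - 1))) := by gcongr; exact hC _
      _ = _ := by rw [Real.div_rpow ht.le hb.le]; ring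
  rw [Real.norm_of_nonneg (by positivity)]
  refine (Real.rpow_le_rpow (norm_nonneg _) h3 hN0.le).trans_eq ?_
  rw [Real.mul_rpow (by positivity) (by positivity), ← Real.rpow_mul ht.le]
  ring_nf

open scoped Pointwise in
theorem exists_le_setIntegral_norm_fderiv_power_scaling {N : ℕ} {b : ℝ} (hN : 1 ≤ N)
    (hb : 1 ≤ b) {v : HS.Euc N → ℝ} (hv : ContDiff ℝ 1 v) (hvc : HasCompactSupport v)
    (hvs : tsupport v ⊆ ball (0 : HS.Euc N) 1)
    (hvx : ∃ x : HS.Euc N, x ≠ 0 ∧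
      gradient v x ≠ (fderiv ℝ v x (‖x‖⁻¹ • x)) • (‖x‖⁻¹ • x)) :
    ∃ c : ℝ, 0 < c ∧ ∀ k l : ℝ, 0 ≤ k → 0 < l → l ≤ 1 →
      c * k ^ N ≤ ∫ x in ball (0 : HS.Euc N) 1,
        ‖fderiv ℝ (fun z : HS.Euc N => k * v (((‖z‖ / b) ^ (l - 1)) • z)) x‖ ^ (N : ℝ) := by
  have hb0 : 0 < b := by linarith
  obtain ⟨y, hy, hvy⟩ := hvx
  obtain ⟨e, hye, he⟩ := exists_inner_eq_zero_fderiv_pos hy hvy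
  obtain ⟨c, hc, δ, hδ, hcδ⟩ := exists_pos_le_fderiv_tangential hv hy hye he
  have he0 : e ≠ 0 := by rintro rfl; simp at he
  have hen : 0 < ‖e‖ := norm_pos_iff.2 he0
  have hρ : 0 < ‖y‖ := norm_pos_iff.2 hy
  have hρ1 : ‖y‖ < 1 := by
    by_contra hcon
    rw [fderiv_of_notMem_tsupport ℝ (fun hm => hcon (by simpa using hvs hm))] at he
    simp at he
  set ε := min ‖y‖ (δ / 2)
  have hε : 0 < ε := lt_min hρ (half_pos hδ)
  have hερ : ε ≤ ‖y‖ := min_le_left _ _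
  have hεδ : 2 * ε ≤ δ := by linarith [min_le_right ‖y‖ (δ / 2)]
  set S : Set (HS.Euc N) := {z | ‖z‖ < 1 ∧ ‖‖y‖ • z - y‖ < ε}
  have hSo : IsOpen S :=
    IsOpen.and (isOpen_lt continuous_norm continuous_const)
      (isOpen_lt ((continuous_const_smul _).sub continuous_const).norm continuous_const)
  have hSn : S.Nonempty := by
    refine ⟨((1 - ε / 2) * ‖y‖⁻¹) • y, ?_, ?_⟩
    · rw [norm_smul, Real.norm_of_nonneg (mul_nonneg (by linarith) (by positivity)), mul_assoc,
        inv_mul_cancel₀ hρ.ne']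
      linarith
    · have e1 : ‖y‖ • ((1 - ε / 2) * ‖y‖⁻¹) • y - y = (-(ε / 2)) • y := by
        rw [smul_smul, mul_left_comm, mul_inv_cancel₀ hρ.ne']
        module
      rw [e1, norm_smul, norm_neg, Real.norm_of_nonneg (by positivity)]
      nlinarith
  have hSfin : volume S ≠ ⊤ :=
    measure_ne_top_of_subset (fun z hz => by simpa using hz.1)
      (measure_ball_lt_top (x := (0 : HS.Euc N)) (r := 1)).ne
  have hSpos : 0 < volume.real S := ENNReal.toReal_pos (hSo.measure_pos _ hSn).ne' hSfin
  refine ⟨(‖y‖ * (c / (2 * ‖e‖))) ^ N * volume.real S, by positivity, fun k l hk hl hl1 => ?_⟩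
  obtain ⟨t, ht, ht1, htρ⟩ := Real.exists_div_rpow_mul_eq hb hl hl1 hρ hρ1
  have hsub : t • S ⊆ ball (0 : HS.Euc N) 1 := by
    rintro _ ⟨z, hz, rfl⟩
    simp only [mem_ball_zero_iff, norm_smul, Real.norm_of_nonneg ht.le]
    nlinarith [hz.1, norm_nonneg z]
  have hlow : ∀ x ∈ t • S, (k * (‖y‖ / t) * (c / (2 * ‖e‖))) ^ N ≤
      ‖fderiv ℝ (fun z : HS.Euc N => k * v (((‖z‖ / b) ^ (l - 1)) • z)) x‖ ^ (N : ℝ) := by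
    rintro _ ⟨z, hz, rfl⟩
    have hz0 : z ≠ 0 := by
      rintro rfl
      have := hz.2
      simp only [smul_zero, zero_sub, norm_neg] at this
      linarith
    have hzp : 0 < ‖z‖ := norm_pos_iff.2 hz0
    have hx0 : t • z ≠ 0 := smul_ne_zero ht.ne' hz0
    have hxn : ‖t • z‖ = t * ‖z‖ := by rw [norm_smul, Real.norm_of_nonneg ht.le]
    have hh : (‖t • z‖ / b) ^ (l - 1) = ‖y‖ / t * ‖z‖ ^ (l - 1) := by
      rw [hxn, mul_div_right_comm, Real.mul_rpow (by positivity) hzp.le, ← htρ]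
      field_simp
    have hyz : ((‖t • z‖ / b) ^ (l - 1)) • t • z = (‖y‖ * ‖z‖ ^ (l - 1)) • z := by
      rw [hh, smul_smul]
      congr 1
      field_simp
    have hnear := norm_rpow_smul_sub_lt hl hl1 hz0 hz.1.le hz.2
    rw [← hyz] at hnear
    have hy1 : ‖((‖t • z‖ / b) ^ (l - 1)) • t • z‖ ≤ 1 := by
      rw [hyz, norm_smul, Real.norm_of_nonneg (by positivity), mul_assoc,
        ← Real.rpow_add_one hzp.ne', sub_add_cancel]
      exact mul_le_one₀ hρ1.le (by positivity) (Real.rpow_le_one hzp.le hz.1.le hl.le)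
    have h1 := le_norm_fderiv_const_mul_comp_norm_smul (h := fun t => (t / b) ^ (l - 1)) hx0
      (Real.hasDerivAt_div_rpow hb0 (norm_pos_iff.2 hx0)) (hv.differentiable one_ne_zero _) hk
      (by positivity) he0 hy1 (hcδ _ (hnear.trans_le hεδ))
    rw [Real.rpow_natCast]
    refine pow_le_pow_left₀ (by positivity) (le_trans ?_ h1) N
    have h2 : ‖y‖ / t ≤ (‖t • z‖ / b) ^ (l - 1) := by
      rw [hh]
      exact le_mul_of_one_le_right (by positivity)
        (Real.one_le_rpow_of_pos_of_le_one_of_nonpos hzp hz.1.le (by linarith))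
    gcongr
  have hint := integrableOn_norm_fderiv_power_scaling (k := k) hN hb0 hl hl1 hv hvc
  have hvol : volume.real (t • S) = t ^ N * volume.real S := by
    rw [measureReal_def, Measure.addHaar_smul, ENNReal.toReal_mul,
      ENNReal.toReal_ofReal (abs_nonneg _), finrank_euclideanSpace, Fintype.card_fin,
      abs_of_pos (by positivity), measureReal_def]
  calc (‖y‖ * (c / (2 * ‖e‖))) ^ N * volume.real S * k ^ N
      = (k * (‖y‖ / t) * (c / (2 * ‖e‖))) ^ N * volume.real (t • S) := by
        have e1 : k * (‖y‖ / t) * (c / (2 * ‖e‖)) * t = k * (‖y‖ * (c / (2 * ‖e‖))) := by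
          field_simp
        rw [hvol, ← mul_assoc, ← mul_pow, e1, mul_pow]
        ring
    _ ≤ _ := setIntegral_ge_of_const_le_real (hSo.smul₀ ht.ne').measurableSet
        (measure_ne_top_of_subset hsub measure_ball_lt_top.ne) hlow (hint.mono_set hsub)
    _ ≤ _ := setIntegral_mono_set hint (.of_forall fun x => by positivity) hsub.eventuallyLE

/-- the two nonlinear scalings behave differently on gradient norms. -/
theorem scalings_different (N : ℕ) (p b a : ℝ) (hN : 2 ≤ N) (hp : 1 < p)
    (hpN : p < (N : ℝ)) (hb : 1 ≤ b) (ha : a ∈ Icc (0 : ℝ) 1) :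
    (∀ v : HS.Euc N → ℝ, ContDiff ℝ 1 v → HasCompactSupport v →
      tsupport v ⊆ ball (0 : HS.Euc N) 1 →
      (∃ x : HS.Euc N, x ≠ 0 ∧
        gradient v x ≠ (fderiv ℝ v x (‖x‖⁻¹ • x)) • (‖x‖⁻¹ • x)) →
      Tendsto (fun m : ℕ => ∫ x in ball (0 : HS.Euc N) 1,
          ‖fderiv ℝ (fun z : HS.Euc N =>
            ((m : ℝ)⁻¹) ^ (-(((N : ℝ) - 1) / (N : ℝ))) *
              v (((‖z‖ / b) ^ ((m : ℝ)⁻¹ - 1)) • z)) x‖ ^ (N : ℝ))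
        atTop atTop) ∧
    (∀ w : HS.Euc N → ℝ, ContDiff ℝ 1 w → HasCompactSupport w →
      tsupport w ⊆ ball (0 : HS.Euc N) 1 →
      ∃ M : ℝ, ∀ m : ℕ, 1 ≤ m →
        (∫ x in ball (0 : HS.Euc N) 1,
          ‖fderiv ℝ (fun z : HS.Euc N =>
            (m : ℝ) ^ (((N : ℝ) - p) / p) *
              w (((m : ℝ) * (1 + a * ((m : ℝ) ^ (((N : ℝ) - p) / (p - 1)) - 1) *
                    ‖z‖ ^ (((N : ℝ) - p) / (p - 1))) ^
                  (-((p - 1) / ((N : ℝ) - p)))) • z)) x‖ ^ p) ≤ M) := by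
  constructor
  · intro v hv hvc hvs hvx
    obtain ⟨c, hc, h⟩ :=
      exists_le_setIntegral_norm_fderiv_power_scaling (by omega : 1 ≤ N) hb hv hvc hvs hvx
    refine tendsto_atTop_mono' _ (f₁ := fun m : ℕ => c * (m : ℝ) ^ (N - 1)) ?_
      ((tendsto_pow_atTop (by omega : N - 1 ≠ 0)).comp
        tendsto_natCast_atTop_atTop |>.const_mul_atTop hc)
    filter_upwards [eventually_ge_atTop 1] with m hm
    have hm1 : (1 : ℝ) ≤ m := by exact_mod_cast hm
    have hm0 : (0 : ℝ) < m := by linarith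
    have hN0 : (N : ℝ) ≠ 0 := by
      have : N ≠ 0 := by omega
      exact_mod_cast this
    refine le_of_eq_of_le ?_
      (h _ (m : ℝ)⁻¹ (by positivity) (by positivity) (inv_le_one_of_one_le₀ hm1))
    rw [← Real.rpow_natCast _ N, ← Real.rpow_mul (by positivity), neg_mul,
      div_mul_cancel₀ _ hN0, Real.inv_rpow hm0.le, Real.rpow_neg hm0.le, inv_inv,
      ← Real.rpow_natCast, Nat.cast_sub (by omega), Nat.cast_one]
  · intro w hw hwc hws
    obtain ⟨M, hM⟩ :=
      exists_setIntegral_norm_fderiv_virtual_scaling_le hN hp hpN ha hw hwc hws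
    exact ⟨M, fun m hm => hM m (by exact_mod_cast hm)⟩
end
end
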